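/- Let α ≠ 0 be a real constant and T > 0. Suppose (u0^ε)_{0 < ε < 1} is a family of C^∞ functions on ℝ such that for every nonnegative integer j there are constants C_j > 0 with ‖∂_x^j u0^ε‖_{L^∞(ℝ)} ≤ C_j ε^{−j} for all 0 < ε < 1. For each ε let u^ε be defined by the Hopf–Cole formula u^ε(x,t) = e^{−αt} (∫_ℝ u0^ε(x − √(4τ(t)ε) z) dμ^ε_{x,t}(z)), where dμ^ε_{x,t}(z) = e^{−(z² + (1/2ε) ∫_0^{x−√(4τ(t)ε) z} u0^ε(s) ds)} dz / ∫_ℝ e^{−(z² + (1/2ε) ∫_0^{x−√(4τ(t)ε) z} u0^ε(s) ds)} dz is a probability measure on ℝ. Then for all nonnegative integers j, k there exists a constant C > 0 such that ‖∂_t^j ∂_x^k u^ε‖_{L^∞(ℝ × (0,T))} ≤ C ε^{−2(j+k)} for all sufficiently small ε > 0; in particular the family (u^ε) is moderate, i.e. defines an element of the Colombeau algebra of generalized functions on ℝ × (0, T). -/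

import Mathlib

open Real Filter MeasureTheory

/-- The time change `τ(t) = (1 - e^{-αt})/α`. -/
noncomputable def tauChange (α t : ℝ) : ℝ := (1 - Real.exp (-α * t)) / α

/-- Exponential growth. -/
def HCEB (g : ℝ → ℝ) : Prop := ∃ A B : ℝ, 0 ≤ A ∧ 0 ≤ B ∧ ∀ y, |g y| ≤ A * Real.exp (B * |y|)

/-- Gaussian average. -/
noncomputable def hcH (g : ℝ → ℝ) (σ x : ℝ) : ℝ := ∫ z : ℝ, Real.exp (-z ^ 2) * g (x - σ * z)

lemma hc_gauss_int (c : ℝ) : Integrable (fun z : ℝ => Real.exp (-z ^ 2 + c * |z|)) := by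
  have h : Integrable (fun z : ℝ => Real.exp (c ^ 2 / 2) * Real.exp (-(1/2) * z ^ 2)) :=
    (integrable_exp_neg_mul_sq (by norm_num : (0:ℝ) < 1/2)).const_mul _
  refine h.mono' (by fun_prop) (ae_of_all _ fun z => ?_)
  rw [Real.norm_eq_abs, abs_of_pos (Real.exp_pos _), ← Real.exp_add]
  apply Real.exp_le_exp.2
  nlinarith [sq_nonneg (c - |z|), sq_abs z]

lemma hc_bound {g : ℝ → ℝ} (hg : HCEB g) (X S : ℝ) : ∃ bd : ℝ → ℝ, Integrable bd ∧
    ∀ x σ z : ℝ, |x| ≤ X → |σ| ≤ S →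
      |Real.exp (-z ^ 2) * g (x - σ * z)| ≤ bd z ∧
      |Real.exp (-z ^ 2) * (z * g (x - σ * z))| ≤ bd z := by
  obtain ⟨A, B, hA, hB, h⟩ := hg
  refine ⟨fun z => (A * Real.exp (B * X)) * Real.exp (-z ^ 2 + (B * S + 1) * |z|),
    (hc_gauss_int _).const_mul _, fun x σ z hx hσ => ?_⟩
  have h1 : |g (x - σ * z)| ≤ A * Real.exp (B * X) * Real.exp (B * S * |z|) := by
    refine (h _).trans ?_
    rw [mul_assoc, ← Real.exp_add]
    gcongr
    have : |x - σ * z| ≤ X + S * |z| := by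
      refine (abs_sub _ _).trans ?_
      rw [abs_mul]
      gcongr
    nlinarith
  have hz : |z| ≤ Real.exp |z| := by linarith [Real.add_one_le_exp |z|]
  have hz1 : 1 ≤ Real.exp |z| := Real.one_le_exp (abs_nonneg z)
  have e : (A * Real.exp (B * X)) * Real.exp (-z ^ 2 + (B * S + 1) * |z|) =
      Real.exp (-z ^ 2) * (Real.exp |z| * (A * Real.exp (B * X) * Real.exp (B * S * |z|))) := by
    rw [show -z ^ 2 + (B * S + 1) * |z| = -z^2 + (|z| + B * S * |z|) by ring, Real.exp_add,
      Real.exp_add]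
    ring
  simp only [e]
  constructor
  · rw [abs_mul, abs_of_pos (Real.exp_pos _)]
    gcongr
    calc _ ≤ 1 * (A * Real.exp (B * X) * Real.exp (B * S * |z|)) := by linarith
      _ ≤ _ := by gcongr
  · rw [abs_mul, abs_of_pos (Real.exp_pos _), abs_mul]
    gcongr

lemma hc_int {g : ℝ → ℝ} (hg : HCEB g) (hc : Continuous g) (σ x : ℝ) :
    Integrable (fun z : ℝ => Real.exp (-z ^ 2) * g (x - σ * z)) ∧
    Integrable (fun z : ℝ => Real.exp (-z ^ 2) * (z * g (x - σ * z))) := by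
  obtain ⟨bd, hbd, h⟩ := hc_bound hg |x| |σ|
  exact ⟨hbd.mono' (by fun_prop) (ae_of_all _ fun z => (h x σ z le_rfl le_rfl).1),
    hbd.mono' (by fun_prop) (ae_of_all _ fun z => (h x σ z le_rfl le_rfl).2)⟩

lemma hc_deriv_x {g g' : ℝ → ℝ} (hg : HCEB g) (hg' : HCEB g') (hc' : Continuous g')
    (hd : ∀ y, HasDerivAt g (g' y) y) (σ x : ℝ) :
    HasDerivAt (fun x => hcH g σ x) (hcH g' σ x) x := by
  have hc : Continuous g := continuous_iff_continuousAt.2 fun y => (hd y).continuousAt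
  obtain ⟨bd, hbd, h⟩ := hc_bound hg' (|x| + 1) |σ|
  refine (hasDerivAt_integral_of_dominated_loc_of_deriv_le
    (F := fun x z => Real.exp (-z ^ 2) * g (x - σ * z))
    (F' := fun x z => Real.exp (-z ^ 2) * g' (x - σ * z)) (bound := bd)
    (Metric.ball_mem_nhds x one_pos)
    (Eventually.of_forall fun y => by fun_prop) (hc_int hg hc σ x).1 (by fun_prop)
    (ae_of_all _ fun z y hy => (h y σ z ?_ le_rfl).1) hbd
    (ae_of_all _ fun z y hy => ?_)).2
  · rw [Metric.mem_ball, Real.dist_eq] at hy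
    have := abs_sub_abs_le_abs_sub y x
    linarith
  · have := (hd (y - σ * z)).comp y ((hasDerivAt_id y).sub_const (σ * z))
    simpa using this.const_mul (Real.exp (-z ^ 2))

lemma hc_deriv_s {g g' g'' : ℝ → ℝ} (hg : HCEB g) (hg' : HCEB g') (hg'' : HCEB g'')
    (hc'' : Continuous g'')
    (hd : ∀ y, HasDerivAt g (g' y) y) (hd' : ∀ y, HasDerivAt g' (g'' y) y) (σ x : ℝ) :
    HasDerivAt (fun σ => hcH g σ x) (σ / 2 * hcH g'' σ x) σ := by
  have hc : Continuous g := continuous_iff_continuousAt.2 fun y => (hd y).continuousAt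
  have hc' : Continuous g' := continuous_iff_continuousAt.2 fun y => (hd' y).continuousAt
  obtain ⟨bd, hbd, h⟩ := hc_bound hg' |x| (|σ| + 1)
  have key : HasDerivAt (fun σ => hcH g σ x)
      (∫ z, -(Real.exp (-z ^ 2) * (z * g' (x - σ * z)))) σ := by
    refine (hasDerivAt_integral_of_dominated_loc_of_deriv_le
      (F := fun σ z => Real.exp (-z ^ 2) * g (x - σ * z))
      (F' := fun σ z => -(Real.exp (-z ^ 2) * (z * g' (x - σ * z)))) (bound := bd)
      (Metric.ball_mem_nhds σ one_pos)
      (Eventually.of_forall fun y => by fun_prop) (hc_int hg hc σ x).1 (by fun_prop)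
      (ae_of_all _ fun z y hy => ?_) hbd
      (ae_of_all _ fun z y hy => ?_)).2
    · rw [norm_neg]
      refine (h x y z le_rfl ?_).2
      rw [Metric.mem_ball, Real.dist_eq] at hy
      have := abs_sub_abs_le_abs_sub y σ
      linarith
    · have := (hd (x - y * z)).comp y (((hasDerivAt_id y).mul_const z).const_sub x)
      exact (this.const_mul (Real.exp (-z ^ 2))).congr_deriv (by ring)
  convert key using 1
  have ibp := integral_mul_deriv_eq_deriv_mul_of_integrable
    (u := fun z : ℝ => g' (x - σ * z)) (u' := fun z => -σ * g'' (x - σ * z))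
    (v := fun z : ℝ => Real.exp (-z ^ 2) / 2) (v' := fun z => -(Real.exp (-z^2) * z))
    (fun z _ => by
      have := (hd' (x - σ * z)).comp z (((hasDerivAt_id z).const_mul σ).const_sub x)
      exact this.congr_deriv (by ring))
    (fun z _ => by
      have := (((hasDerivAt_pow 2 z).neg).exp).div_const 2
      exact this.congr_deriv (by simp; ring))
    (((hc_int hg' hc' σ x).2.neg).congr (ae_of_all _ fun z => by simp; ring))
    (((hc_int hg'' hc'' σ x).1.const_mul (-σ/2)).congr (ae_of_all _ fun z => by simp; ring))
    (((hc_int hg' hc' σ x).1.const_mul (1/2)).congr (ae_of_all _ fun z => by simp; ring))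
  calc σ / 2 * hcH g'' σ x
      = -∫ z : ℝ, -σ * g'' (x - σ * z) * (Real.exp (-z ^ 2) / 2) := by
        rw [hcH, ← integral_const_mul, ← integral_neg]
        congr 1; ext z; ring
    _ = _ := by
        rw [← ibp]
        congr 1; ext z; ring

/-- Families of order `m`. -/
def HCGood (m : ℕ) (p : ℝ → ℝ → ℝ) : Prop :=
  (∀ ε ∈ Set.Ioo (0:ℝ) 1, ContDiff ℝ (⊤ : ℕ∞) (p ε)) ∧
  ∀ j : ℕ, ∃ C > 0, ∀ ε ∈ Set.Ioo (0:ℝ) 1, ∀ x : ℝ, |iteratedDeriv j (p ε) x| ≤ C / ε ^ (m + j)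

lemma HCGood.deriv {m : ℕ} {p : ℝ → ℝ → ℝ} (h : HCGood m p) :
    HCGood (m + 1) (fun ε y => deriv (p ε) y) := by
  refine ⟨fun ε hε => ?_, fun j => ?_⟩
  · exact (contDiff_infty_iff_deriv.1 (h.1 ε hε)).2
  · obtain ⟨C, hC, h2⟩ := h.2 (j + 1)
    refine ⟨C, hC, fun ε hε x => ?_⟩
    have := h2 ε hε x
    rw [iteratedDeriv_succ'] at this
    rwa [show m + 1 + j = m + (j + 1) by ring]

lemma HCGood.sub {m : ℕ} {p q : ℝ → ℝ → ℝ} (hp : HCGood m p) (hq : HCGood m q) :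
    HCGood m (fun ε y => p ε y - q ε y) := by
  refine ⟨fun ε hε => (hp.1 ε hε).sub (hq.1 ε hε), fun j => ?_⟩
  obtain ⟨C, hC, h2⟩ := hp.2 j
  obtain ⟨C', hC', h2'⟩ := hq.2 j
  refine ⟨C + C', by positivity, fun ε hε x => ?_⟩
  rw [iteratedDeriv_fun_sub (((hp.1 ε hε).of_le (by exact_mod_cast le_top)).contDiffAt)
    (((hq.1 ε hε).of_le (by exact_mod_cast le_top)).contDiffAt), add_div]
  exact (abs_sub _ _).trans (add_le_add (h2 ε hε x) (h2' ε hε x))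

lemma HCGood.mul {m n : ℕ} {p q : ℝ → ℝ → ℝ} (hp : HCGood m p) (hq : HCGood n q) :
    HCGood (m + n) (fun ε y => p ε y * q ε y) := by
  refine ⟨fun ε hε => (hp.1 ε hε).mul (hq.1 ε hε), fun j => ?_⟩
  choose C hC h2 using hp.2
  choose C' hC' h2' using hq.2
  refine ⟨∑ i ∈ Finset.range (j + 1), (j.choose i : ℝ) * C i * C' (j - i) + 1, ?_, 
    fun ε hε x => ?_⟩
  · have : 0 ≤ ∑ i ∈ Finset.range (j + 1), (j.choose i : ℝ) * C i * C' (j - i) :=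
      Finset.sum_nonneg fun i _ => by have := hC i; have := hC' (j - i); positivity
    linarith
  rw [iteratedDeriv_fun_mul (((hp.1 ε hε).of_le (by exact_mod_cast le_top)).contDiffAt)
    (((hq.1 ε hε).of_le (by exact_mod_cast le_top)).contDiffAt)]
  have hε0 : 0 < ε := hε.1
  calc _ ≤ ∑ i ∈ Finset.range (j + 1), |(j.choose i : ℝ) * iteratedDeriv i (p ε) x *
        iteratedDeriv (j - i) (q ε) x| := Finset.abs_sum_le_sum_abs _ _
    _ ≤ ∑ i ∈ Finset.range (j + 1), (j.choose i : ℝ) * C i * C' (j - i) / ε ^ (m + n + j) := by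
        refine Finset.sum_le_sum fun i hi => ?_
        have hij : i ≤ j := by simpa [Nat.lt_succ_iff] using hi
        rw [abs_mul, abs_mul, Nat.abs_cast]
        have := hC i
        have := hC' (j - i)
        calc _ ≤ (j.choose i : ℝ) * (C i / ε ^ (m + i)) * (C' (j - i) / ε ^ (n + (j - i))) := by
              gcongr
              · exact h2 i ε hε x
              · exact h2' _ ε hε x
          _ = _ := by
              rw [show m + n + j = (m + i) + (n + (j - i)) by omega, pow_add ε (m + i)]
              rw [mul_assoc, div_mul_div_comm, mul_div_assoc', mul_assoc]
    _ ≤ _ := by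
        rw [← Finset.sum_div]
        gcongr
        linarith

lemma HCGood.inv_eps {m : ℕ} {p : ℝ → ℝ → ℝ} (hp : HCGood m p) :
    HCGood (m + 1) (fun ε y => 1 / (2 * ε) * p ε y) := by
  refine ⟨fun ε hε => contDiff_const.mul (hp.1 ε hε), fun j => ?_⟩
  obtain ⟨C, hC, h2⟩ := hp.2 j
  refine ⟨C, hC, fun ε hε x => ?_⟩
  have hε0 : 0 < ε := hε.1
  rw [iteratedDeriv_const_mul _ (((hp.1 ε hε).of_le (by exact_mod_cast le_top)).contDiffAt),
    abs_mul, abs_of_pos (by positivity)]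
  calc _ ≤ 1 / (2 * ε) * (C / ε ^ (m + j)) := by gcongr; exact h2 ε hε x
    _ = C / ε ^ (m + 1 + j) / 2 := by
      rw [show m + 1 + j = m + j + 1 by ring, pow_succ]; field_simp
    _ ≤ _ := half_le_self (by positivity)

lemma HCGood.mul_eps {m : ℕ} {p : ℝ → ℝ → ℝ} (hp : HCGood (m + 1) p) :
    HCGood m (fun ε y => ε * p ε y) := by
  refine ⟨fun ε hε => contDiff_const.mul (hp.1 ε hε), fun j => ?_⟩
  obtain ⟨C, hC, h2⟩ := hp.2 j
  refine ⟨C, hC, fun ε hε x => ?_⟩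
  have hε0 : 0 < ε := hε.1
  rw [iteratedDeriv_const_mul _ (((hp.1 ε hε).of_le (by exact_mod_cast le_top)).contDiffAt),
    abs_mul, abs_of_pos hε0]
  calc _ ≤ ε * (C / ε ^ (m + 1 + j)) := by gcongr; exact h2 ε hε x
    _ = _ := by
      rw [show m + 1 + j = m + j + 1 by ring, pow_succ]; field_simp

lemma HCGood.one : HCGood 0 (fun _ _ => 1) := by
  refine ⟨fun ε hε => contDiff_const, fun j => ⟨1, one_pos, fun ε hε x => ?_⟩⟩
  have hε0 : 0 < ε := hε.1
  rw [iteratedDeriv_const]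
  have h1 : ε ^ (0 + j) ≤ 1 := pow_le_one₀ hε0.le hε.2.le
  have : 1 ≤ 1 / ε ^ (0 + j) := by rw [le_div_iff₀ (by positivity)]; linarith
  split_ifs
  · simpa using this
  · simp; positivity

/-- Hopf-Cole weight. -/
noncomputable def hcPhi (u0 : ℝ → ℝ → ℝ) (ε y : ℝ) : ℝ :=
  Real.exp (-(1 / (2 * ε) * ∫ s in (0:ℝ)..y, u0 ε s))

/-- Twisted derivative. -/
noncomputable def hcD (u0 p : ℝ → ℝ → ℝ) (ε y : ℝ) : ℝ :=
  deriv (p ε) y - p ε y * (1 / (2 * ε) * u0 ε y)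

/-- Weighted averages. -/
noncomputable def hcN (α : ℝ) (u0 p : ℝ → ℝ → ℝ) (ε x t : ℝ) : ℝ :=
  hcH (fun y => p ε y * hcPhi u0 ε y) (Real.sqrt (4 * tauChange α t * ε)) x

lemma HCGood.D {m : ℕ} {u0 p : ℝ → ℝ → ℝ} (hu : HCGood 0 u0) (hp : HCGood m p) :
    HCGood (m + 1) (hcD u0 p) :=
  hp.deriv.sub (hp.mul hu.inv_eps)

lemma hcPhi_deriv {u0 : ℝ → ℝ → ℝ} (hu : HCGood 0 u0) {ε : ℝ} (hε : ε ∈ Set.Ioo (0:ℝ) 1) (y : ℝ) :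
    HasDerivAt (hcPhi u0 ε) (-(1 / (2 * ε) * u0 ε y) * hcPhi u0 ε y) y := by
  have := ((hu.1 ε hε).continuous.integral_hasStrictDerivAt 0 y).hasDerivAt
  have := ((this.const_mul (1 / (2 * ε))).fun_neg).exp
  exact this.congr_deriv (by rw [hcPhi]; ring)

lemma hc_g_deriv {m : ℕ} {u0 p : ℝ → ℝ → ℝ} (hu : HCGood 0 u0) (hp : HCGood m p)
    {ε : ℝ} (hε : ε ∈ Set.Ioo (0:ℝ) 1) (y : ℝ) :
    HasDerivAt (fun y => p ε y * hcPhi u0 ε y) (hcD u0 p ε y * hcPhi u0 ε y) y := by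
  have h1 : HasDerivAt (p ε) (deriv (p ε) y) y :=
    ((hp.1 ε hε).differentiable (by simp)).differentiableAt.hasDerivAt
  exact (h1.mul (hcPhi_deriv hu hε y)).congr_deriv (by rw [hcD]; ring)

lemma hc_g_cont {m : ℕ} {u0 p : ℝ → ℝ → ℝ} (hu : HCGood 0 u0) (hp : HCGood m p)
    {ε : ℝ} (hε : ε ∈ Set.Ioo (0:ℝ) 1) : Continuous (fun y => p ε y * hcPhi u0 ε y) :=
  continuous_iff_continuousAt.2 fun y => (hc_g_deriv hu hp hε y).continuousAt

lemma hc_g_EB {m : ℕ} {u0 p : ℝ → ℝ → ℝ} (hu : HCGood 0 u0) (hp : HCGood m p)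
    {ε : ℝ} (hε : ε ∈ Set.Ioo (0:ℝ) 1) : HCEB (fun y => p ε y * hcPhi u0 ε y) := by
  obtain ⟨C, hC, h⟩ := hp.2 0
  obtain ⟨C', hC', h'⟩ := hu.2 0
  have hε0 : 0 < ε := hε.1
  refine ⟨C / ε ^ (m + 0), C' / (2 * ε), by positivity, by positivity, fun y => ?_⟩
  rw [abs_mul, hcPhi, abs_of_pos (Real.exp_pos _)]
  have h1 := h ε hε y
  rw [iteratedDeriv_zero] at h1
  gcongr
  have h2 : ‖∫ s in (0:ℝ)..y, u0 ε s‖ ≤ C' * |y - 0| :=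
    intervalIntegral.norm_integral_le_of_norm_le_const fun s _ => by
      simpa using h' ε hε s
  rw [Real.norm_eq_abs, sub_zero] at h2
  have h3 := neg_abs_le (∫ s in (0:ℝ)..y, u0 ε s)
  calc _ = 1 / (2 * ε) * (-∫ s in (0:ℝ)..y, u0 ε s) := by ring
    _ ≤ 1 / (2 * ε) * (C' * |y|) := by gcongr; linarith
    _ = _ := by ring

lemma hcN_dx {m : ℕ} {u0 p : ℝ → ℝ → ℝ} (hu : HCGood 0 u0) (hp : HCGood m p)
    {ε : ℝ} (hε : ε ∈ Set.Ioo (0:ℝ) 1) (α x t : ℝ) :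
    HasDerivAt (fun x => hcN α u0 p ε x t) (hcN α u0 (hcD u0 p) ε x t) x :=
  hc_deriv_x (hc_g_EB hu hp hε) (hc_g_EB hu (hu.D hp) hε) (hc_g_cont hu (hu.D hp) hε)
    (hc_g_deriv hu hp hε) _ x

lemma hc_tau_pos {α t : ℝ} (hα : α ≠ 0) (ht : 0 < t) : 0 < tauChange α t := by
  unfold tauChange
  rcases lt_or_gt_of_ne hα with h | h
  · apply div_pos_of_neg_of_neg _ h
    have : 1 < Real.exp (-α * t) := Real.one_lt_exp_iff.2 (by nlinarith)
    linarith
  · apply div_pos _ h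
    have : Real.exp (-α * t) < 1 := by
      rw [← Real.exp_zero]; exact Real.exp_lt_exp.2 (by nlinarith)
    linarith

lemma hc_sigma_deriv {α t ε : ℝ} (hα : α ≠ 0) (ht : 0 < t) (hε : 0 < ε) :
    HasDerivAt (fun t => Real.sqrt (4 * tauChange α t * ε))
      (2 * ε * Real.exp (-α * t) / Real.sqrt (4 * tauChange α t * ε)) t := by
  have hτ := hc_tau_pos hα ht
  have h1 : HasDerivAt (tauChange α) (Real.exp (-α * t)) t := by
    have := ((((hasDerivAt_id t).const_mul (-α)).exp).const_sub 1).div_const α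
    exact this.congr_deriv (by simp; field_simp)
  have h2 := ((h1.const_mul 4).mul_const ε).sqrt (by positivity)
  have : 0 < Real.sqrt (4 * tauChange α t * ε) := Real.sqrt_pos.2 (by positivity)
  exact h2.congr_deriv (by field_simp; ring)

lemma hcN_dt {m : ℕ} {u0 p : ℝ → ℝ → ℝ} (hu : HCGood 0 u0) (hp : HCGood m p)
    {ε : ℝ} (hε : ε ∈ Set.Ioo (0:ℝ) 1) {α t : ℝ} (hα : α ≠ 0) (ht : 0 < t) (x : ℝ) :
    HasDerivAt (fun t => hcN α u0 p ε x t)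
      (Real.exp (-α * t) * hcN α u0 (fun ε y => ε * hcD u0 (hcD u0 p) ε y) ε x t) t := by
  have h1 := hc_deriv_s (hc_g_EB hu hp hε) (hc_g_EB hu (hu.D hp) hε)
    (hc_g_EB hu (hu.D (hu.D hp)) hε) (hc_g_cont hu (hu.D (hu.D hp)) hε)
    (hc_g_deriv hu hp hε) (hc_g_deriv hu (hu.D hp) hε) (Real.sqrt (4 * tauChange α t * ε)) x
  have h2 := h1.comp t (hc_sigma_deriv hα ht hε.1)
  have hτ := hc_tau_pos hα ht
  have hε0 : 0 < ε := hε.1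
  have hs : 0 < Real.sqrt (4 * tauChange α t * ε) := Real.sqrt_pos.2 (by positivity)
  refine h2.congr_deriv ?_
  have e : hcN α u0 (fun ε y => ε * hcD u0 (hcD u0 p) ε y) ε x t =
      ε * hcN α u0 (hcD u0 (hcD u0 p)) ε x t := by
    unfold hcN hcH
    rw [← integral_const_mul]
    congr 1; ext z; ring
  rw [e]
  unfold hcN
  field_simp

lemma hcN_pos {u0 : ℝ → ℝ → ℝ} (hu : HCGood 0 u0)
    {ε : ℝ} (hε : ε ∈ Set.Ioo (0:ℝ) 1) (α x t : ℝ) :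
    0 < hcN α u0 (fun _ _ => 1) ε x t := by
  have hi := (hc_int (hc_g_EB hu HCGood.one hε) (hc_g_cont hu HCGood.one hε)
    (Real.sqrt (4 * tauChange α t * ε)) x).1
  unfold hcN hcH
  simp only [one_mul, hcPhi, ← Real.exp_add] at hi ⊢
  exact integral_exp_pos hi

lemma hcN_bound {m : ℕ} {u0 p : ℝ → ℝ → ℝ} (hu : HCGood 0 u0) (hp : HCGood m p)
    {ε : ℝ} (hε : ε ∈ Set.Ioo (0:ℝ) 1) (α x t : ℝ) {M : ℝ} (hM : ∀ y, |p ε y| ≤ M) :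
    |hcN α u0 p ε x t| ≤ M * hcN α u0 (fun _ _ => 1) ε x t := by
  have hi := (hc_int (hc_g_EB hu HCGood.one hε) (hc_g_cont hu HCGood.one hε)
    (Real.sqrt (4 * tauChange α t * ε)) x).1
  unfold hcN hcH
  rw [← integral_const_mul, ← Real.norm_eq_abs]
  refine norm_integral_le_of_norm_le (hi.const_mul M) (ae_of_all _ fun z => ?_)
  have hpos : 0 < hcPhi u0 ε (x - Real.sqrt (4 * tauChange α t * ε) * z) := Real.exp_pos _
  rw [Real.norm_eq_abs, abs_mul, abs_mul, abs_of_pos (Real.exp_pos _), abs_of_pos hpos]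
  have := hM (x - Real.sqrt (4 * tauChange α t * ε) * z)
  calc _ ≤ Real.exp (-z ^ 2) * (M * hcPhi u0 ε (x - Real.sqrt (4 * tauChange α t * ε) * z)) := by
        gcongr
    _ = _ := by ring

/-- The algebra of families generated by the weighted averages. -/
inductive HCCls (α : ℝ) (u0 : ℝ → ℝ → ℝ) : ℕ → (ℝ → ℝ → ℝ → ℝ) → Prop
  | ratio (m : ℕ) (p : ℝ → ℝ → ℝ) (hp : HCGood m p) : HCCls α u0 m
      (fun ε x t => hcN α u0 p ε x t / hcN α u0 (fun _ _ => 1) ε x t)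
  | exp (m : ℕ) (c : ℝ) : HCCls α u0 m (fun _ _ t => c * Real.exp (-α * t))
  | add (m : ℕ) (F G : ℝ → ℝ → ℝ → ℝ) : HCCls α u0 m F → HCCls α u0 m G →
      HCCls α u0 m (fun ε x t => F ε x t + G ε x t)
  | sub (m : ℕ) (F G : ℝ → ℝ → ℝ → ℝ) : HCCls α u0 m F → HCCls α u0 m G →
      HCCls α u0 m (fun ε x t => F ε x t - G ε x t)
  | mul (m n k : ℕ) (F G : ℝ → ℝ → ℝ → ℝ) : m + n = k → HCCls α u0 m F → HCCls α u0 n G →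
      HCCls α u0 k (fun ε x t => F ε x t * G ε x t)

lemma HCCls.bound {α : ℝ} {u0 : ℝ → ℝ → ℝ} (hu : HCGood 0 u0) (T : ℝ) {m : ℕ}
    {F : ℝ → ℝ → ℝ → ℝ} (hF : HCCls α u0 m F) :
    ∃ C > 0, ∀ ε ∈ Set.Ioo (0:ℝ) 1, ∀ x : ℝ, ∀ t ∈ Set.Ioo (0:ℝ) T, |F ε x t| ≤ C / ε ^ m := by
  induction hF with
  | ratio m p hp =>
    obtain ⟨C, hC, h⟩ := hp.2 0
    refine ⟨C, hC, fun ε hε x t ht => ?_⟩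
    have hpos := hcN_pos hu hε α x t
    rw [abs_div, abs_of_pos hpos, div_le_iff₀ hpos]
    exact hcN_bound hu hp hε α x t fun y => by simpa using h ε hε y
  | exp m c =>
    refine ⟨|c| * Real.exp (|α| * T) + 1, by positivity, fun ε hε x t ht => ?_⟩
    have hε0 : 0 < ε := hε.1
    have h1 : ε ^ m ≤ 1 := pow_le_one₀ hε0.le hε.2.le
    rw [abs_mul, abs_of_pos (Real.exp_pos _), le_div_iff₀ (by positivity)]
    have h2 : Real.exp (-α * t) ≤ Real.exp (|α| * T) := by
      apply Real.exp_le_exp.2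
      have := neg_abs_le α
      nlinarith [abs_nonneg α, ht.1, ht.2]
    calc _ ≤ |c| * Real.exp (|α| * T) * 1 := by gcongr
      _ ≤ _ := by linarith
  | add m F G _ _ ihF ihG =>
    obtain ⟨C, hC, h⟩ := ihF
    obtain ⟨C', hC', h'⟩ := ihG
    refine ⟨C + C', by positivity, fun ε hε x t ht => ?_⟩
    rw [add_div]
    exact (abs_add_le _ _).trans (add_le_add (h ε hε x t ht) (h' ε hε x t ht))
  | sub m F G _ _ ihF ihG =>
    obtain ⟨C, hC, h⟩ := ihF
    obtain ⟨C', hC', h'⟩ := ihG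
    refine ⟨C + C', by positivity, fun ε hε x t ht => ?_⟩
    rw [add_div]
    exact (abs_sub _ _).trans (add_le_add (h ε hε x t ht) (h' ε hε x t ht))
  | mul m n k F G hk _ _ ihF ihG =>
    obtain ⟨C, hC, h⟩ := ihF
    obtain ⟨C', hC', h'⟩ := ihG
    refine ⟨C * C', by positivity, fun ε hε x t ht => ?_⟩
    have hε0 : 0 < ε := hε.1
    rw [← hk, pow_add, ← div_mul_div_comm, abs_mul]
    have := h ε hε x t ht
    have := h' ε hε x t ht
    gcongr

lemma HCCls.dx {α : ℝ} {u0 : ℝ → ℝ → ℝ} (hu : HCGood 0 u0) {m : ℕ}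
    {F : ℝ → ℝ → ℝ → ℝ} (hF : HCCls α u0 m F) :
    ∃ G, HCCls α u0 (m + 1) G ∧ ∀ ε ∈ Set.Ioo (0:ℝ) 1, ∀ x t : ℝ,
      HasDerivAt (fun x => F ε x t) (G ε x t) x := by
  induction hF with
  | ratio m p hp =>
    refine ⟨_, .sub _ _ _ (.ratio _ _ (hu.D hp))
      (.mul m (0 + 1) _ _ _ (by ring) (.ratio m p hp) (.ratio _ _ (hu.D HCGood.one))), ?_⟩
    intro ε hε x t
    have hpos := hcN_pos hu hε α x t
    exact ((hcN_dx hu hp hε α x t).div (hcN_dx hu HCGood.one hε α x t) hpos.ne').congr_deriv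
      (by field_simp)
  | exp m c =>
    refine ⟨_, .exp _ 0, fun ε hε x t => ?_⟩
    simpa using hasDerivAt_const x (c * Real.exp (-α * t))
  | add m F G _ _ ihF ihG =>
    obtain ⟨F', hF', h⟩ := ihF
    obtain ⟨G', hG', h'⟩ := ihG
    exact ⟨_, .add _ _ _ hF' hG', fun ε hε x t => (h ε hε x t).add (h' ε hε x t)⟩
  | sub m F G _ _ ihF ihG =>
    obtain ⟨F', hF', h⟩ := ihF
    obtain ⟨G', hG', h'⟩ := ihG
    exact ⟨_, .sub _ _ _ hF' hG', fun ε hε x t => (h ε hε x t).sub (h' ε hε x t)⟩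
  | mul m n k F G hk hF hG ihF ihG =>
    obtain ⟨F', hF', h⟩ := ihF
    obtain ⟨G', hG', h'⟩ := ihG
    exact ⟨_, .add _ _ _ (.mul _ _ _ _ _ (by omega) hF' hG) (.mul _ _ _ _ _ (by omega) hF hG'),
      fun ε hε x t => (h ε hε x t).mul (h' ε hε x t)⟩

lemma HCCls.dt {α : ℝ} (hα : α ≠ 0) {u0 : ℝ → ℝ → ℝ} (hu : HCGood 0 u0) {m : ℕ}
    {F : ℝ → ℝ → ℝ → ℝ} (hF : HCCls α u0 m F) :
    ∃ G, HCCls α u0 (m + 1) G ∧ ∀ ε ∈ Set.Ioo (0:ℝ) 1, ∀ x t : ℝ, 0 < t →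
      HasDerivAt (fun t => F ε x t) (G ε x t) t := by
  induction hF with
  | ratio m p hp =>
    refine ⟨_, .mul 0 (m + 1) _ _ _ (by ring) (.exp 0 1)
      (.sub _ _ _ (.ratio (m + 1) _ (hu.D (hu.D hp)).mul_eps)
      (.mul m (0 + 1) _ _ _ (by ring) (.ratio m p hp)
        (.ratio _ _ (hu.D (hu.D HCGood.one)).mul_eps))), ?_⟩
    intro ε hε x t ht
    have hpos := hcN_pos hu hε α x t
    exact ((hcN_dt hu hp hε hα ht x).div (hcN_dt hu HCGood.one hε hα ht x) hpos.ne').congr_deriv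
      (by field_simp)
  | exp m c =>
    refine ⟨_, .exp _ (-α * c), fun ε hε x t _ => ?_⟩
    have := (((hasDerivAt_id t).const_mul (-α)).exp).const_mul c
    exact this.congr_deriv (by simp; ring)
  | add m F G _ _ ihF ihG =>
    obtain ⟨F', hF', h⟩ := ihF
    obtain ⟨G', hG', h'⟩ := ihG
    exact ⟨_, .add _ _ _ hF' hG', fun ε hε x t ht => (h ε hε x t ht).add (h' ε hε x t ht)⟩
  | sub m F G _ _ ihF ihG =>
    obtain ⟨F', hF', h⟩ := ihF
    obtain ⟨G', hG', h'⟩ := ihG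
    exact ⟨_, .sub _ _ _ hF' hG', fun ε hε x t ht => (h ε hε x t ht).sub (h' ε hε x t ht)⟩
  | mul m n k F G hk hF hG ihF ihG =>
    obtain ⟨F', hF', h⟩ := ihF
    obtain ⟨G', hG', h'⟩ := ihG
    exact ⟨_, .add _ _ _ (.mul _ _ _ _ _ (by omega) hF' hG) (.mul _ _ _ _ _ (by omega) hF hG'),
      fun ε hε x t ht => (h ε hε x t ht).mul (h' ε hε x t ht)⟩

lemma HCCls.iter_dx {α : ℝ} {u0 : ℝ → ℝ → ℝ} (hu : HCGood 0 u0) {m : ℕ}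
    {F : ℝ → ℝ → ℝ → ℝ} (hF : HCCls α u0 m F) (k : ℕ) :
    ∃ G, HCCls α u0 (m + k) G ∧ ∀ ε ∈ Set.Ioo (0:ℝ) 1, ∀ x t : ℝ,
      iteratedDeriv k (fun x => F ε x t) x = G ε x t := by
  induction k with
  | zero => exact ⟨F, hF, fun ε hε x t => by simp⟩
  | succ k ih =>
    obtain ⟨G, hG, h⟩ := ih
    obtain ⟨G', hG', h'⟩ := hG.dx hu
    refine ⟨G', hG', fun ε hε x t => ?_⟩
    rw [iteratedDeriv_succ, show iteratedDeriv k (fun x => F ε x t) = fun x => G ε x t from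
      funext fun x => h ε hε x t]
    exact (h' ε hε x t).deriv

lemma HCCls.iter_dt {α : ℝ} (hα : α ≠ 0) {u0 : ℝ → ℝ → ℝ} (hu : HCGood 0 u0) {m : ℕ}
    {F : ℝ → ℝ → ℝ → ℝ} (hF : HCCls α u0 m F) (k : ℕ) :
    ∃ G, HCCls α u0 (m + k) G ∧ ∀ ε ∈ Set.Ioo (0:ℝ) 1, ∀ x t : ℝ, 0 < t →
      iteratedDeriv k (fun t => F ε x t) t = G ε x t := by
  induction k with
  | zero => exact ⟨F, hF, fun ε hε x t _ => by simp⟩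
  | succ k ih =>
    obtain ⟨G, hG, h⟩ := ih
    obtain ⟨G', hG', h'⟩ := hG.dt hα hu
    refine ⟨G', hG', fun ε hε x t ht => ?_⟩
    rw [iteratedDeriv_succ]
    have : iteratedDeriv k (fun t => F ε x t) =ᶠ[nhds t] fun t => G ε x t := by
      filter_upwards [lt_mem_nhds ht] with s hs using h ε hε x s hs
    rw [this.deriv_eq]
    exact (h' ε hε x t ht).deriv

/-- **moderateness of the Hopf–Cole family: Colombeau estimates.**
Let `(u0ε)_{0<ε<1}` be a family of smooth functions with `‖∂_x^j u0ε‖_∞ ≤ C_j ε^{-j}`, and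
let `u^ε` be given by the Hopf–Cole formula
`u^ε(x,t) = e^{-αt} ∫ u0ε(x - √(4τ(t)ε) z) dμ^ε_{x,t}(z)` where `dμ^ε_{x,t}` is the
normalized Gaussian-type probability measure with weight
`exp(-(z² + (1/2ε)∫_0^{x-√(4τ(t)ε)z} u0ε))`. Then for all `j, k` there is `C > 0` with
`‖∂_t^j ∂_x^k u^ε‖_{L^∞(ℝ × (0,T))} ≤ C ε^{-2(j+k)}` for all sufficiently small `ε > 0`;
in particular the family `(u^ε)` is moderate, i.e. defines an element of the Colombeau
algebra of generalized functions on `ℝ × (0, T)`. -/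
theorem hopf_cole_family_is_moderate
    (α T : ℝ) (hα : α ≠ 0) (hT : 0 < T)
    (u0ε : ℝ → ℝ → ℝ)
    (hsm : ∀ ε ∈ Set.Ioo (0:ℝ) 1, ContDiff ℝ (⊤ : ℕ∞) (u0ε ε))
    (hder : ∀ j : ℕ, ∃ C > 0, ∀ ε ∈ Set.Ioo (0:ℝ) 1, ∀ x : ℝ,
      |iteratedDeriv j (u0ε ε) x| ≤ C / ε ^ j)
    (w : ℝ → ℝ → ℝ → ℝ → ℝ)
    (hw : ∀ ε x t z, w ε x t z =
      Real.exp (-(z ^ 2 + (1 / (2 * ε)) *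
        ∫ s in (0:ℝ)..(x - Real.sqrt (4 * tauChange α t * ε) * z), u0ε ε s)))
    (uε : ℝ → ℝ → ℝ → ℝ)
    (huε : ∀ ε x t, uε ε x t =
      Real.exp (-α * t) *
        (∫ z : ℝ, u0ε ε (x - Real.sqrt (4 * tauChange α t * ε) * z) * w ε x t z) /
        (∫ z : ℝ, w ε x t z)) :
    ∀ j k : ℕ, ∃ C > 0, ∃ ε0 > 0, ∀ ε : ℝ, 0 < ε → ε < ε0 → ε < 1 →
      ∀ x t : ℝ, t ∈ Set.Ioo (0:ℝ) T →
        |iteratedDeriv j (fun s => iteratedDeriv k (fun x' => uε ε x' s) x) t|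
          ≤ C / ε ^ (2 * (j + k)) := by
  intro j k
  have hu : HCGood 0 u0ε := ⟨hsm, fun j => by simpa using hder j⟩
  have hF : HCCls α u0ε 0 (fun ε x t => 1 * Real.exp (-α * t) *
      (hcN α u0ε u0ε ε x t / hcN α u0ε (fun _ _ => 1) ε x t)) :=
    .mul 0 0 0 _ _ rfl (.exp 0 1) (.ratio 0 _ hu)
  have heq : uε = (fun ε x t => 1 * Real.exp (-α * t) *
      (hcN α u0ε u0ε ε x t / hcN α u0ε (fun _ _ => 1) ε x t)) := by
    funext ε x t
    have e : ∀ z, w ε x t z = Real.exp (-z ^ 2) *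
        hcPhi u0ε ε (x - Real.sqrt (4 * tauChange α t * ε) * z) := by
      intro z
      rw [hw, hcPhi, ← Real.exp_add]
      congr 1; ring
    rw [huε, mul_div_assoc, one_mul]
    simp only [e, hcN, hcH, one_mul]
    congr 3
    ext z; ring
  rw [← heq] at hF
  obtain ⟨G, hG, h⟩ := hF.iter_dx hu k
  obtain ⟨G', hG', h'⟩ := hG.iter_dt hα hu j
  obtain ⟨C, hC, hb⟩ := hG'.bound hu T
  refine ⟨C, hC, 1, one_pos, fun ε hε _ hε1 x t ht => ?_⟩
  have hm : ε ∈ Set.Ioo (0:ℝ) 1 := ⟨hε, hε1⟩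
  rw [show (fun s => iteratedDeriv k (fun x' => uε ε x' s) x) = fun s => G ε x s from
    funext fun s => h ε hm x s, h' ε hm x t ht.1]
  refine (hb ε hm x t ht).trans ?_
  have : ε ^ (2 * (j + k)) ≤ ε ^ (0 + k + j) := pow_le_pow_of_le_one hε.le hε1.le (by omega)
  gcongr
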